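/- Let ω : Fin T → ℝ and φ : Fin T → ℝ, and define the sinusoidal encoding γ : ℝ → (Fin T → ℝ) by γ(x) j = sin(ω j * x + φ j). If P : (Fin T → ℝ) → ℝ is a polynomial function of total degree at most d, then the composite function x ↦ P (γ x) lies in the ℝ-linear span of the set of functions { x ↦ sin(ω' * x + φ') : φ' ∈ ℝ, ω' = Σ_{j} m j * ω j for some m : Fin T → ℤ with Σ_j |m j| ≤ d }. (This is the spectral-bias structure of Eqn. (2): a network with sinusoidal input encoding and polynomial nonlinearity can only represent linear combinations of harmonics of the encoded frequencies.) -/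

import Mathlib

/-- The span of the sinusoids whose frequencies are integer combinations of the `ω j` with
coefficients of total absolute value at most `d`. -/
def harmonicSpan {ι : Type*} [Fintype ι] (ω : ι → ℝ) (d : ℕ) : Submodule ℝ (ℝ → ℝ) :=
  Submodule.span ℝ
    {g : ℝ → ℝ | ∃ (φ' : ℝ) (m : ι → ℤ),
      (∑ j, |m j|) ≤ (d : ℤ) ∧
      g = fun x : ℝ => Real.sin ((∑ j, (m j : ℝ) * ω j) * x + φ')}

namespace harmonicSpan

variable {ι : Type*} [Fintype ι] (ω : ι → ℝ)

theorem mono {m n : ℕ} (h : m ≤ n) : harmonicSpan ω m ≤ harmonicSpan ω n := by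
  refine Submodule.span_mono ?_
  rintro g ⟨θ, k, hk, rfl⟩
  exact ⟨θ, k, hk.trans (by exact_mod_cast h), rfl⟩

theorem one_mem : (1 : ℝ → ℝ) ∈ harmonicSpan ω 0 := by
  refine Submodule.subset_span ⟨Real.pi / 2, 0, by simp, ?_⟩
  ext x
  simp

theorem sum_abs_add_single_le [DecidableEq ι] (m : ι → ℤ) (j : ι) (c : ℤ) :
    ∑ i, |(m + Pi.single j c : ι → ℤ) i| ≤ (∑ i, |m i|) + |c| := by
  calc ∑ i, |(m + Pi.single j c : ι → ℤ) i| ≤ ∑ i, (|m i| + |(Pi.single j c : ι → ℤ) i|) :=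
        Finset.sum_le_sum fun i _ => abs_add_le _ _
    _ = (∑ i, |m i|) + |c| := by
        rw [Finset.sum_add_distrib]
        congr 1
        rw [Finset.sum_eq_single j (fun i _ hi => by simp [hi]) (by simp)]
        simp

theorem sum_add_single_mul [DecidableEq ι] (m : ι → ℤ) (j : ι) (c : ℤ) :
    ∑ i, ((m + Pi.single j c : ι → ℤ) i : ℝ) * ω i = (∑ i, (m i : ℝ) * ω i) + c * ω j := by
  simp only [Pi.add_apply, Int.cast_add, add_mul, Finset.sum_add_distrib]
  congr 1
  rw [Finset.sum_eq_single j (fun i _ hi => by simp [hi]) (by simp)]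
  simp

theorem sin_mul_sin_eq (a b : ℝ) :
    Real.sin a * Real.sin b =
      1 / 2 * Real.sin (a - b + Real.pi / 2) - 1 / 2 * Real.sin (a + b + Real.pi / 2) := by
  rw [Real.sin_add_pi_div_two, Real.sin_add_pi_div_two, Real.cos_sub, Real.cos_add]
  ring

theorem mul_sin_mem {n : ℕ} {f : ℝ → ℝ} (hf : f ∈ harmonicSpan ω n) (j : ι) (θ : ℝ) :
    (f * fun x => Real.sin (ω j * x + θ)) ∈ harmonicSpan ω (n + 1) := by
  classical
  induction hf using Submodule.span_induction with
  | zero => simp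
  | add f g _ _ hf hg => rw [add_mul]; exact add_mem hf hg
  | smul c f _ hf => rw [smul_mul_assoc]; exact Submodule.smul_mem _ c hf
  | mem f hf =>
    obtain ⟨ψ, m, hm, rfl⟩ := hf
    have key (c : ℤ) (hc : |c| = 1) (ξ : ℝ) :
        (fun x : ℝ => Real.sin (((∑ i, (m i : ℝ) * ω i) + c * ω j) * x + ξ)) ∈
          harmonicSpan ω (n + 1) := by
      refine Submodule.subset_span ⟨ξ, m + Pi.single j c, ?_, ?_⟩
      · have := sum_abs_add_single_le m j c
        push_cast
        linarith
      · simp only [sum_add_single_mul]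
    convert sub_mem
      (Submodule.smul_mem _ (1 / 2 : ℝ) (key (-1) (by simp) (ψ - θ + Real.pi / 2)))
      (Submodule.smul_mem _ (1 / 2 : ℝ) (key 1 (by simp) (ψ + θ + Real.pi / 2))) using 1
    ext x
    simp only [Pi.mul_apply, Pi.sub_apply, Pi.smul_apply, smul_eq_mul, sin_mul_sin_eq]
    push_cast
    ring_nf

theorem mul_sin_pow_mem {n : ℕ} {f : ℝ → ℝ} (hf : f ∈ harmonicSpan ω n) (j : ι) (θ : ℝ) (k : ℕ) :
    (f * (fun x => Real.sin (ω j * x + θ)) ^ k) ∈ harmonicSpan ω (n + k) := by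
  induction k with
  | zero => simpa using hf
  | succ k ih =>
    rw [pow_succ, ← mul_assoc]
    exact mul_sin_mem ω ih j θ

theorem prod_sin_pow_mem (φ : ι → ℝ) (e : ι → ℕ) (s : Finset ι) :
    (∏ j ∈ s, (fun x => Real.sin (ω j * x + φ j)) ^ e j) ∈ harmonicSpan ω (∑ j ∈ s, e j) := by
  classical
  induction s using Finset.induction_on with
  | empty => simpa using one_mem ω
  | insert j s hj ih =>
    rw [Finset.prod_insert hj, Finset.sum_insert hj, mul_comm, add_comm]
    exact mul_sin_pow_mem ω ih j (φ j) (e j)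

end harmonicSpan


/-- Spectral-bias structure (Eqn. (2)): if `γ x j = sin (ω j * x + φ j)` is a sinusoidal
encoding and `P` is a multivariate polynomial of total degree at most `d`, then the
composite `x ↦ P (γ x)` lies in the ℝ-linear span of the sinusoids `x ↦ sin (ω' * x + φ')`
whose frequencies `ω'` are integer combinations `∑ j, m j * ω j` with `∑ j, |m j| ≤ d`. -/
theorem spectral_bias_polynomial_of_sinusoidal_encoding
    {T : ℕ} (ω φ : Fin T → ℝ) (γ : ℝ → (Fin T → ℝ))
    (hγ : ∀ x j, γ x j = Real.sin (ω j * x + φ j))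
    (d : ℕ) (P : MvPolynomial (Fin T) ℝ) (hP : P.totalDegree ≤ d) :
    (fun x : ℝ => MvPolynomial.eval (γ x) P) ∈
      Submodule.span ℝ
        {g : ℝ → ℝ | ∃ (φ' : ℝ) (m : Fin T → ℤ),
          (∑ j, |m j|) ≤ (d : ℤ) ∧
          g = fun x : ℝ => Real.sin ((∑ j, (m j : ℝ) * ω j) * x + φ')} := by
  change _ ∈ harmonicSpan ω d
  have hsum : (fun x : ℝ => MvPolynomial.eval (γ x) P) =
      ∑ e ∈ P.support, P.coeff e •
        ∏ j ∈ e.support, (fun x => Real.sin (ω j * x + φ j)) ^ e j := by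
    ext x
    simp [MvPolynomial.eval_eq, hγ]
  rw [hsum]
  refine sum_mem fun e he => Submodule.smul_mem _ _ ?_
  exact harmonicSpan.mono ω ((MvPolynomial.le_totalDegree he).trans hP)
    (harmonicSpan.prod_sin_pow_mem ω φ e e.support)
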